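/- arXiv:0708.2321 — 3 statements merged into one kernel-verified Lean document; each statement's English description precedes it below -/
import Mathlib

section
/- Let η̄: ℝ^d → ℝ be a Borel function, f̄ = 1{η̄ ≥ 1/2}, and 1 ≤ p < ∞. For any distribution P of (X,Y) satisfying the margin assumption (MA) with parameters α > 0, C₀ > 0, one has R(f̄) − R(f*) ≤ C₁(α,p) ‖η̄ − η‖_p^{p(1+α)/(p+α)}, where C₁(α,p) = 2(α+p)p^{−1}(p/α)^{α/(α+p)} C₀^{(p−1)/(α+p)} and ‖·‖_p denotes the L_p(ℝ^d, P_X) norm. -/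
open MeasureTheory ENNReal Matrix
open scoped Classical

noncomputable section

abbrev Euc (d : ℕ) := EuclideanSpace ℝ (Fin d)

/-- Margin (low noise) assumption (MA) with parameters `α`, `C₀`:
`P_X(0 < |η(X) − 1/2| ≤ t) ≤ C₀ t^α` for all `t > 0`. -/
def margin (d : ℕ) (α C₀ : ℝ) (PX : Measure (Euc d)) (η : Euc d → ℝ) : Prop :=
  ∀ t : ℝ, 0 < t →
    PX {x | 0 < |η x - 1/2| ∧ |η x - 1/2| ≤ t} ≤ ENNReal.ofReal (C₀ * t ^ α)

/-- The plug-in rule `1{η ≥ 1/2}`; applied to the true regression function this is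
the Bayes rule `f*`. -/
def plugin (d : ℕ) (η : Euc d → ℝ) : Euc d → Bool :=
  fun x => if 1/2 ≤ η x then true else false

/-- Excess risk `R(f) − R(f*) = E[|2η(X)−1| 1{f(X) ≠ f*(X)}]`. -/
def excessRisk (d : ℕ) (PX : Measure (Euc d)) (η : Euc d → ℝ) (f : Euc d → Bool) : ℝ :=
  ∫ x, (if f x = plugin d η x then 0 else |2 * η x - 1|) ∂PX

/-- Joint distribution `P` of `(X,Y)` on `ℝ^d × ℝ` (with `Y ∈ {0,1}`) determined by the
marginal `PX` of `X` and the regression function `η(x) = P(Y = 1 | X = x)`. -/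
def joint (d : ℕ) (PX : Measure (Euc d)) (η : Euc d → ℝ) : Measure (Euc d × ℝ) :=
  PX.bind fun x =>
    ENNReal.ofReal (η x) • Measure.dirac (x, (1:ℝ)) +
      ENNReal.ofReal (1 - η x) • Measure.dirac (x, (0:ℝ))

/-- Law `P^⊗n` of the i.i.d. sample `(X₁,Y₁),…,(Xₙ,Yₙ)`. -/
def sampleLaw (d n : ℕ) (PX : Measure (Euc d)) (η : Euc d → ℝ) :
    Measure (Fin n → Euc d × ℝ) :=
  Measure.pi fun _ => joint d PX η

/-- Expected excess risk `E[R(f̂ₙ)] − R(f*)` of a classifier `f̂ₙ`. -/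
def expectedExcess (d n : ℕ) (PX : Measure (Euc d)) (η : Euc d → ℝ)
    (fhat : (Fin n → Euc d × ℝ) → Euc d → Bool) : ℝ :=
  ∫ D, excessRisk d PX η (fhat D) ∂(sampleLaw d n PX η)

/-- Excess risk `R(f) − R(f*) = E[|2η(X)−1| 1{f(X) ≠ f*(X)}]`, as an extended
nonnegative real. -/
def excessRiskE (d : ℕ) (PX : Measure (Euc d)) (η : Euc d → ℝ) (f : Euc d → Bool) : ℝ≥0∞ :=
  ∫⁻ x in {x | f x ≠ plugin d η x}, ENNReal.ofReal |2 * η x - 1| ∂PX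

/-- The threshold balancing the two parts of the margin bound attains the optimal constant. -/
theorem exists_threshold_eq {α C₀ p E : ℝ} (hα : 0 < α) (hC₀ : 0 < C₀) (hp : 1 < p)
    (hE : 0 < E) :
    ∃ t : ℝ, 0 < t ∧
      2 * (E * (C₀ * t ^ α) ^ (1 - 1 / p)) + 2 * (t ^ (1 - p) * E ^ p) =
        2 * (α + p) * p⁻¹ * (p / α) ^ (α / (α + p)) * C₀ ^ ((p - 1) / (α + p)) *
          E ^ (p * (1 + α) / (p + α)) := by
  have hp0 : 0 < p := by linarith
  have hp1 : p - 1 ≠ 0 := by linarith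
  have hs : α + p ≠ 0 := by positivity
  have hs' : p + α ≠ 0 := by positivity
  obtain ⟨u, hu⟩ : ∃ u, p / α = Real.exp u := ⟨_, (Real.exp_log (by positivity)).symm⟩
  obtain ⟨v, rfl⟩ : ∃ v, E = Real.exp v := ⟨_, (Real.exp_log hE).symm⟩
  obtain ⟨w, rfl⟩ : ∃ w, C₀ = Real.exp w := ⟨_, (Real.exp_log hC₀).symm⟩
  refine ⟨Real.exp (p / ((p - 1) * (α + p)) * u + p / (α + p) * v - 1 / (α + p) * w),
    Real.exp_pos _, ?_⟩
  have hk : 2 * (α + p) * p⁻¹ = 2 + 2 * Real.exp (-u) := by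
    rw [Real.exp_neg, ← hu]
    field_simp
    ring
  rw [hk, hu]
  simp only [← Real.exp_mul, ← Real.exp_add]
  rw [mul_assoc, mul_assoc, ← Real.exp_add, ← Real.exp_add, add_mul (2 : ℝ), mul_assoc 2 (Real.exp (-u)),
    ← Real.exp_add]
  congr 3
  · field_simp
    ring
  · field_simp
    ring

theorem one_le_margin_constant {α : ℝ} (hα : 0 < α) :
    1 ≤ (α + 1) * (1 / α) ^ (α / (α + 1)) := by
  have h : α ^ (α / (α + 1)) ≤ α + 1 := by
    calc α ^ (α / (α + 1)) ≤ (α + 1) ^ (α / (α + 1)) :=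
          Real.rpow_le_rpow hα.le (by linarith) (by positivity)
      _ ≤ (α + 1) ^ (1 : ℝ) :=
          Real.rpow_le_rpow_of_exponent_le (by linarith)
            ((div_le_one (by positivity)).2 (by linarith))
      _ = α + 1 := Real.rpow_one _
  rw [one_div, Real.inv_rpow hα.le, ← div_eq_mul_inv, one_le_div (by positivity)]
  exact h

theorem abs_le_of_plugin_ne {d : ℕ} {η ηbar : Euc d → ℝ} {x : Euc d}
    (h : plugin d ηbar x ≠ plugin d η x) : |η x - 1 / 2| ≤ |ηbar x - η x| := by
  unfold plugin at h
  split_ifs at h with h1 h2 h2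
  · exact absurd rfl h
  · rw [abs_of_neg (by linarith), abs_of_pos (by linarith)]
    linarith
  · rw [abs_of_nonneg (by linarith), abs_of_neg (by linarith)]
    linarith
  · exact absurd rfl h

theorem measurableSet_plugin_ne {d : ℕ} {η ηbar : Euc d → ℝ} (hη : Measurable η)
    (hηbar : Measurable ηbar) : MeasurableSet {x | plugin d ηbar x ≠ plugin d η x} := by
  have h : ∀ {ζ : Euc d → ℝ}, Measurable ζ → Measurable (plugin d ζ) := fun hζ =>
    Measurable.ite (measurableSet_le measurable_const hζ) measurable_const measurable_const
  exact (measurableSet_eq_fun (h hηbar) (h hη)).compl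

/-- The excess risk of a plug-in rule is at most twice the `L¹` error. -/
theorem excessRiskE_plugin_le {d : ℕ} {PX : Measure (Euc d)} {η ηbar : Euc d → ℝ}
    (hη : Measurable η) (hηbar : Measurable ηbar) :
    excessRiskE d PX η (plugin d ηbar) ≤ 2 * ∫⁻ x, ‖ηbar x - η x‖ₑ ∂PX := by
  rw [← lintegral_const_mul' _ _ (by simp)]
  refine (setLIntegral_mono' (measurableSet_plugin_ne hη hηbar) fun x hx => ?_).trans
    (setLIntegral_le_lintegral _ _)
  have h := abs_le_of_plugin_ne hx
  rw [show 2 * η x - 1 = 2 * (η x - 1 / 2) by ring, abs_mul, abs_two,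
    ENNReal.ofReal_mul (by norm_num), ENNReal.ofReal_ofNat, Real.enorm_eq_ofReal_abs]
  gcongr

/-- Splitting the excess risk of a plug-in rule at distance `t` from the level `1/2`. -/
theorem excessRiskE_plugin_le_add {d : ℕ} {PX : Measure (Euc d)} {η ηbar : Euc d → ℝ}
    (hη : Measurable η) (hηbar : Measurable ηbar) {p t : ℝ} (hp : 1 ≤ p) (ht : 0 < t) :
    excessRiskE d PX η (plugin d ηbar) ≤
      2 * (∫⁻ x in {x | 0 < |η x - 1/2| ∧ |η x - 1/2| ≤ t}, ‖ηbar x - η x‖ₑ ∂PX) +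
        2 * (ENNReal.ofReal (t ^ (1 - p)) * ∫⁻ x, ‖ηbar x - η x‖ₑ ^ p ∂PX) := by
  have hS : MeasurableSet {x | 0 < |η x - 1/2| ∧ |η x - 1/2| ≤ t} := by
    have : Measurable fun x => |η x - 1/2| := by fun_prop
    exact (measurableSet_lt measurable_const this).inter (measurableSet_le this measurable_const)
  rw [← lintegral_indicator hS, ← lintegral_const_mul' _ _ ENNReal.ofReal_ne_top,
    ← lintegral_const_mul' _ _ (by simp), ← lintegral_const_mul' _ _ (by simp),
    ← lintegral_add_right _ (by fun_prop)]
  refine (setLIntegral_mono' (measurableSet_plugin_ne hη hηbar) fun x hx => ?_).trans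
    (setLIntegral_le_lintegral _ _)
  have h := abs_le_of_plugin_ne hx
  rw [show 2 * η x - 1 = 2 * (η x - 1 / 2) by ring, abs_mul, abs_two,
    ENNReal.ofReal_mul (by norm_num), ENNReal.ofReal_ofNat, ← mul_add]
  gcongr
  rcases (abs_nonneg (η x - 1 / 2)).eq_or_lt with h0 | h0
  · rw [← h0]
    simp
  by_cases hxt : |η x - 1 / 2| ≤ t
  · rw [Set.indicator_of_mem (show x ∈ {x | 0 < |η x - 1/2| ∧ |η x - 1/2| ≤ t} from ⟨h0, hxt⟩),
      Real.enorm_eq_ofReal_abs]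
    exact le_add_right (ENNReal.ofReal_le_ofReal h)
  · push Not at hxt
    refine le_add_left ?_
    rw [Real.enorm_eq_ofReal_abs, ENNReal.ofReal_rpow_of_nonneg (abs_nonneg _) (by linarith),
      ← ENNReal.ofReal_mul (by positivity)]
    refine ENNReal.ofReal_le_ofReal (h.trans ?_)
    set g := |ηbar x - η x|
    have hg : 0 < g := h0.trans_le h
    have h1 : g ^ (1 - p) ≤ t ^ (1 - p) :=
      Real.rpow_le_rpow_of_nonpos ht (hxt.le.trans h) (by linarith)
    calc g = g ^ (1 - p) * g ^ p := by rw [← Real.rpow_add hg]; simp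
      _ ≤ t ^ (1 - p) * g ^ p := by gcongr

theorem setLIntegral_enorm_le_eLpNorm_mul {Ω : Type*} [MeasurableSpace Ω] {μ : Measure Ω}
    {g : Ω → ℝ} (hg : AEStronglyMeasurable g μ) {p : ℝ} (hp : 1 ≤ p) (S : Set Ω) :
    ∫⁻ x in S, ‖g x‖ₑ ∂μ ≤ eLpNorm g (ENNReal.ofReal p) μ * μ S ^ (1 - 1 / p) := by
  have h := eLpNorm_le_eLpNorm_mul_rpow_measure_univ (p := 1) (q := ENNReal.ofReal p)
    (by simpa using hp) (hg.restrict (s := S))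
  rw [eLpNorm_one_eq_lintegral_enorm, Measure.restrict_apply_univ,
    ENNReal.toReal_ofReal (by linarith), ENNReal.toReal_one, div_one] at h
  exact h.trans (by gcongr; exact Measure.restrict_le_self)

theorem statement13 (d : ℕ) (α C₀ p : ℝ) (hα : 0 < α) (hC₀ : 0 < C₀) (hp : 1 ≤ p)
    (PX : Measure (Euc d)) (η ηbar : Euc d → ℝ) (hprob : IsProbabilityMeasure PX)
    (hmeas : Measurable η) (hmeasbar : Measurable ηbar)
    (hrange : ∀ x, η x ∈ Set.Icc (0:ℝ) 1) (hMA : margin d α C₀ PX η) :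
    excessRiskE d PX η (plugin d ηbar) ≤
      ENNReal.ofReal
          (2 * (α + p) * p⁻¹ * (p / α) ^ (α / (α + p)) * C₀ ^ ((p - 1) / (α + p))) *
        eLpNorm (fun x => ηbar x - η x) (ENNReal.ofReal p) PX ^ (p * (1 + α) / (p + α)) := by
  have hp0 : 0 < p := by linarith
  have hgm : AEStronglyMeasurable (fun x => ηbar x - η x) PX :=
    (hmeasbar.sub hmeas).aestronglyMeasurable
  rcases hp.eq_or_lt with rfl | hp1
  · refine (excessRiskE_plugin_le hmeas hmeasbar).trans ?_
    rw [ENNReal.ofReal_one, eLpNorm_one_eq_lintegral_enorm, one_mul,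
      div_self (by positivity : 1 + α ≠ 0), ENNReal.rpow_one]
    gcongr
    rw [← ENNReal.ofReal_ofNat]
    refine ENNReal.ofReal_le_ofReal ?_
    have := one_le_margin_constant hα
    simp only [inv_one, sub_self, zero_div, Real.rpow_zero, mul_one]
    linarith
  have hexp : 0 < p * (1 + α) / (p + α) := by positivity
  set N := eLpNorm (fun x => ηbar x - η x) (ENNReal.ofReal p) PX with hN
  have hNp : ∫⁻ x, ‖ηbar x - η x‖ₑ ^ p ∂PX = N ^ p := by
    rw [hN, eLpNorm_eq_lintegral_rpow_enorm_toReal (by simpa using hp0) (by simp),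
      ENNReal.toReal_ofReal hp0.le, ← ENNReal.rpow_mul, one_div_mul_cancel hp0.ne',
      ENNReal.rpow_one]
  have hL1 := setLIntegral_enorm_le_eLpNorm_mul hgm hp
  rcases eq_or_ne N ⊤ with hNtop | hNtop
  · rw [hNtop, ENNReal.top_rpow_of_pos hexp, ENNReal.mul_top]
    · exact le_top
    · exact (ENNReal.ofReal_pos.2 (by positivity)).ne'
  rcases eq_or_ne N 0 with hN0 | hN0
  · refine (excessRiskE_plugin_le hmeas hmeasbar).trans ?_
    have h := hL1 Set.univ
    rw [← hN, hN0, zero_mul, Measure.restrict_univ] at h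
    rw [nonpos_iff_eq_zero.1 h, mul_zero]
    exact zero_le
  obtain ⟨E, hE, hNE⟩ : ∃ E : ℝ, 0 < E ∧ N = ENNReal.ofReal E :=
    ⟨N.toReal, ENNReal.toReal_pos hN0 hNtop, (ENNReal.ofReal_toReal hNtop).symm⟩
  obtain ⟨t, ht, hteq⟩ := exists_threshold_eq hα hC₀ hp1 hE
  have hq : 0 ≤ 1 - 1 / p := by
    rw [sub_nonneg, div_le_one hp0]
    exact hp
  calc excessRiskE d PX η (plugin d ηbar)
      ≤ 2 * (N * ENNReal.ofReal (C₀ * t ^ α) ^ (1 - 1 / p)) +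
          2 * (ENNReal.ofReal (t ^ (1 - p)) * N ^ p) := by
        refine (excessRiskE_plugin_le_add hmeas hmeasbar hp ht).trans ?_
        rw [hNp]
        gcongr
        refine (hL1 _).trans ?_
        gcongr
        exact hMA t ht
    _ = ENNReal.ofReal (2 * (E * (C₀ * t ^ α) ^ (1 - 1 / p)) + 2 * (t ^ (1 - p) * E ^ p)) := by
        rw [hNE, ENNReal.ofReal_rpow_of_nonneg (by positivity) hq,
          ENNReal.ofReal_rpow_of_nonneg hE.le hp0.le, ← ENNReal.ofReal_mul hE.le,
          ← ENNReal.ofReal_mul (by positivity), ENNReal.ofReal_add (by positivity) (by positivity),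
          ENNReal.ofReal_mul zero_le_two, ENNReal.ofReal_mul zero_le_two, ENNReal.ofReal_ofNat]
    _ = _ := by
        rw [hteq, hNE, ENNReal.ofReal_rpow_of_nonneg hE.le hexp.le,
          ← ENNReal.ofReal_mul (by positivity)]
end
end

section
/- Let η̄: ℝ^d → ℝ be a Borel function, f̄ = 1{η̄ ≥ 1/2}, and 1 ≤ p < ∞. For any distribution P of (X,Y) and any t > 0, one has R(f̄) − R(f*) ≤ 2‖η − η̄‖_p [P_X(0 < |η(X) − 1/2| ≤ t)]^{(p−1)/p} + 2‖η − η̄‖_p^p / t^{p−1}, where ‖·‖_p denotes the L_p(ℝ^d, P_X) norm. (No margin assumption is required; the bound follows from the Hölder and Markov inequalities.) -/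
open MeasureTheory ENNReal Matrix
open scoped Classical

noncomputable section

lemma measurable_plugin {d : ℕ} {η : Euc d → ℝ} (hη : Measurable η) :
    Measurable (plugin d η) :=
  Measurable.ite (measurableSet_le measurable_const hη) measurable_const measurable_const

/-- Where two plug-in rules disagree, the functions lie on opposite sides of `1/2`. -/
lemma abs_sub_half_le_of_plugin_ne {d : ℕ} {η ηbar : Euc d → ℝ} {x : Euc d}
    (h : plugin d ηbar x ≠ plugin d η x) : |η x - 1/2| ≤ |η x - ηbar x| := by
  unfold plugin at h
  by_cases h₁ : 1/2 ≤ ηbar x <;> by_cases h₂ : 1/2 ≤ η x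
  · rw [if_pos h₁, if_pos h₂] at h
    exact absurd rfl h
  · rw [abs_of_nonpos (by linarith), abs_of_nonpos (by linarith)]
    linarith
  · rw [abs_of_nonneg (by linarith), abs_of_nonneg (by linarith)]
    linarith
  · rw [if_neg h₁, if_neg h₂] at h
    exact absurd rfl h

/-- The elementary inequality behind Markov's inequality for `p`-th moments. -/
lemma le_rpow_div_rpow_sub_one {p s t : ℝ} (hp : 1 ≤ p) (ht : 0 < t) (hts : t ≤ s) :
    s ≤ s ^ p / t ^ (p - 1) := by
  have hs : 0 < s := ht.trans_le hts
  rw [le_div_iff₀ (Real.rpow_pos_of_pos ht _)]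
  calc s * t ^ (p - 1) ≤ s * s ^ (p - 1) := by
        have := Real.rpow_le_rpow ht.le hts (sub_nonneg.2 hp)
        gcongr
    _ = s ^ p := by rw [Real.rpow_sub_one hs.ne', mul_div_cancel₀ _ hs.ne']

/-- Hölder's inequality on a set, for an exponent `p ∈ [1, ∞)`. -/
lemma setLIntegral_enorm_le_eLpNorm_mul_rpow {α : Type*} [MeasurableSpace α] {μ : Measure α}
    {f : α → ℝ} (hf : AEStronglyMeasurable f μ) {p : ℝ} (hp : 1 ≤ p) (s : Set α) :
    ∫⁻ x in s, ‖f x‖ₑ ∂μ ≤ eLpNorm f (ENNReal.ofReal p) μ * μ s ^ ((p - 1) / p) := by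
  have hp₀ : 0 < p := one_pos.trans_le hp
  have h := eLpNorm_le_eLpNorm_mul_rpow_measure_univ (p := 1) (q := ENNReal.ofReal p)
    (ENNReal.one_le_ofReal.2 hp) (hf.restrict (s := s))
  rw [eLpNorm_one_eq_lintegral_enorm, Measure.restrict_apply_univ, ENNReal.toReal_one,
    ENNReal.toReal_ofReal hp₀.le, div_one, one_sub_div hp₀.ne'] at h
  exact h.trans (by gcongr; exact Measure.restrict_le_self)

lemma lintegral_enorm_rpow_eq_eLpNorm_rpow {α : Type*} [MeasurableSpace α] (μ : Measure α)
    (f : α → ℝ) {p : ℝ} (hp : 0 < p) :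
    ∫⁻ x, ‖f x‖ₑ ^ p ∂μ = eLpNorm f (ENNReal.ofReal p) μ ^ p := by
  rw [eLpNorm_eq_lintegral_rpow_enorm_toReal (ENNReal.ofReal_pos.2 hp).ne' ENNReal.ofReal_ne_top,
    ENNReal.toReal_ofReal hp.le, ← ENNReal.rpow_mul, one_div_mul_cancel hp.ne', ENNReal.rpow_one]

theorem statement14 (d : ℕ) (p t : ℝ) (hp : 1 ≤ p) (ht : 0 < t)
    (PX : Measure (Euc d)) (η ηbar : Euc d → ℝ) (hprob : IsProbabilityMeasure PX)
    (hmeas : Measurable η) (hmeasbar : Measurable ηbar)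
    (hrange : ∀ x, η x ∈ Set.Icc (0:ℝ) 1) :
    excessRiskE d PX η (plugin d ηbar) ≤
      2 * eLpNorm (fun x => η x - ηbar x) (ENNReal.ofReal p) PX *
          PX {x | 0 < |η x - 1/2| ∧ |η x - 1/2| ≤ t} ^ ((p - 1) / p) +
        2 * eLpNorm (fun x => η x - ηbar x) (ENNReal.ofReal p) PX ^ p /
          ENNReal.ofReal (t ^ (p - 1)) := by
  have hp₀ : 0 < p := one_pos.trans_le hp
  set A : Set (Euc d) := {x | 0 < |η x - 1/2| ∧ |η x - 1/2| ≤ t}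
  set g : Euc d → ℝ := fun x => η x - ηbar x
  have hgm : Measurable g := hmeas.sub hmeasbar
  have hηm : Measurable fun x => |η x - 1/2| := (hmeas.sub_const _).abs
  have hAm : MeasurableSet A :=
    (measurableSet_lt measurable_const hηm).inter (measurableSet_le hηm measurable_const)
  have hDm : MeasurableSet {x | plugin d ηbar x ≠ plugin d η x} :=
    (measurableSet_eq_fun (measurable_plugin hmeasbar) (measurable_plugin hmeas)).compl
  have hpt : ∀ x ∈ {x | plugin d ηbar x ≠ plugin d η x},
      ENNReal.ofReal |2 * η x - 1| ≤
        2 * A.indicator (fun x => ‖g x‖ₑ) x + 2 * ‖g x‖ₑ ^ p / ENNReal.ofReal (t ^ (p - 1)) := by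
    intro x hx
    have hle : |η x - 1/2| ≤ |g x| := abs_sub_half_le_of_plugin_ne hx
    have htwo : ENNReal.ofReal |2 * η x - 1| = 2 * ENNReal.ofReal |η x - 1/2| := by
      rw [show 2 * η x - 1 = 2 * (η x - 1/2) by ring, abs_mul, abs_two,
        ENNReal.ofReal_mul zero_le_two, ENNReal.ofReal_ofNat]
    rw [htwo, Real.enorm_eq_ofReal_abs]
    by_cases hxA : x ∈ A
    · rw [Set.indicator_of_mem hxA, Real.enorm_eq_ofReal_abs]
      exact le_add_right (by gcongr)
    · rcases (abs_nonneg (η x - 1/2)).eq_or_lt with h₀ | h₀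
      · rw [← h₀, ENNReal.ofReal_zero, mul_zero]
        exact zero_le
      · have hgt : t ≤ |g x| := (not_le.1 fun h => hxA ⟨h₀, h⟩).le.trans hle
        refine le_add_left ?_
        rw [mul_div_assoc, ENNReal.ofReal_rpow_of_nonneg (abs_nonneg _) hp₀.le,
          ← ENNReal.ofReal_div_of_pos (Real.rpow_pos_of_pos ht _)]
        gcongr
        exact hle.trans (le_rpow_div_rpow_sub_one hp ht hgt)
  calc excessRiskE d PX η (plugin d ηbar)
      ≤ ∫⁻ x in {x | plugin d ηbar x ≠ plugin d η x}, (2 * A.indicator (fun x => ‖g x‖ₑ) x +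
          2 * ‖g x‖ₑ ^ p / ENNReal.ofReal (t ^ (p - 1))) ∂PX := setLIntegral_mono' hDm hpt
    _ ≤ ∫⁻ x, (2 * A.indicator (fun x => ‖g x‖ₑ) x +
          2 * ‖g x‖ₑ ^ p / ENNReal.ofReal (t ^ (p - 1))) ∂PX := setLIntegral_le_lintegral _ _
    _ = 2 * ∫⁻ x in A, ‖g x‖ₑ ∂PX +
          2 * (∫⁻ x, ‖g x‖ₑ ^ p ∂PX) / ENNReal.ofReal (t ^ (p - 1)) := by
        have hm : Measurable (A.indicator fun x => ‖g x‖ₑ) := hgm.enorm.indicator hAm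
        have hmp : Measurable fun x => ‖g x‖ₑ ^ p := hgm.enorm.pow_const p
        simp only [div_eq_mul_inv]
        rw [lintegral_add_left (hm.const_mul 2), lintegral_const_mul 2 hm,
          lintegral_indicator hAm, lintegral_mul_const _ (hmp.const_mul 2),
          lintegral_const_mul 2 hmp]
    _ ≤ _ := by
        rw [lintegral_enorm_rpow_eq_eLpNorm_rpow PX g hp₀, mul_assoc 2 (eLpNorm _ _ _)]
        gcongr
        exact setLIntegral_enorm_le_eLpNorm_mul_rpow hgm.aestronglyMeasurable hp A
end
end

section
/- Let d ≥ 1 and l ≥ 0 be integers and let c > 0 and 0 < a ≤ λ[B(0,c)]. Then the infimum, over all vectors W = (W_s)_{|s|≤l} with Euclidean norm ‖W‖ = 1 and all compact sets S ⊆ B(0,c) ⊂ ℝ^d with Lebesgue measure λ[S] ≥ a, of ∫_S (∑_{|s|≤l} W_s u^s)² du is attained and strictly positive. -/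
open MeasureTheory ENNReal Matrix
open scoped Classical

noncomputable section

/-- Multi-indices `s ∈ ℕ^d` with `|s| = ∑ sᵢ ≤ l`. -/
abbrev MultiIdx (d l : ℕ) := {s : Fin d → Fin (l + 1) // ∑ i, (s i : ℕ) ≤ l}

/-- Monomial `u^s = u₁^{s₁} ⋯ u_d^{s_d}`. -/
def mon {d l : ℕ} (s : MultiIdx d l) (u : Euc d) : ℝ := ∏ i, (u i) ^ ((s.1 i : ℕ))

/-- Polynomial of degree `l` on `ℝ^d` with coefficient vector `T`. -/
def polyEval {d l : ℕ} (T : MultiIdx d l → ℝ) (u : Euc d) : ℝ :=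
  ∑ s : MultiIdx d l, T s * mon s u

open Set Filter Topology

/-- The zero set of a nonzero real polynomial in finitely many variables is Lebesgue-null. -/
theorem volume_eval_mvPolynomial_eq_zero {n : ℕ} {p : MvPolynomial (Fin n) ℝ} (hp : p ≠ 0) :
    volume {x : Fin n → ℝ | MvPolynomial.eval x p = 0} = 0 := by
  induction n with
  | zero =>
    have hc : p = MvPolynomial.C (p.coeff 0) := MvPolynomial.eq_C_of_isEmpty p
    have h0 : p.coeff 0 ≠ 0 := fun h => hp (by rw [hc, h, map_zero])
    have : {x : Fin 0 → ℝ | MvPolynomial.eval x p = 0} = ∅ := by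
      ext x
      rw [hc]
      simpa using h0
    rw [this, measure_empty]
  | succ n ih =>
    set q := MvPolynomial.finSuccEquiv ℝ n p with hq
    have hq0 : q ≠ 0 := by simpa [hq] using hp
    have hlead := ih (Polynomial.leadingCoeff_ne_zero.mpr hq0)
    set A : Set ((Fin n → ℝ) × ℝ) :=
      {z | MvPolynomial.eval (Fin.cons z.2 z.1 : Fin (n + 1) → ℝ) p = 0} with hA
    have hcont : Continuous fun z : (Fin n → ℝ) × ℝ =>
        MvPolynomial.eval (Fin.cons z.2 z.1 : Fin (n + 1) → ℝ) p := by
      refine (MvPolynomial.continuous_eval p).comp (continuous_pi fun i => ?_)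
      refine Fin.cases ?_ (fun j => ?_) i
      · simpa using continuous_snd
      · simpa using (by fun_prop : Continuous fun z : (Fin n → ℝ) × ℝ => z.1 j)
    have hAm : MeasurableSet A := (isClosed_singleton.preimage hcont).measurableSet
    have hA0 : (volume : Measure (Fin n → ℝ)).prod (volume : Measure ℝ) A = 0 := by
      rw [Measure.measure_prod_null hAm]
      have hne : ∀ᵐ s : Fin n → ℝ, MvPolynomial.eval s q.leadingCoeff ≠ 0 := by
        rw [ae_iff]
        simpa using hlead
      filter_upwards [hne] with s hs
      have hr : Polynomial.map (MvPolynomial.eval s) q ≠ 0 := fun h =>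
        hs (by simpa using congrArg (fun r => Polynomial.coeff r q.natDegree) h)
      refine measure_mono_null (t := ((Polynomial.map (MvPolynomial.eval s) q).roots.toFinset :
        Set ℝ)) (fun y hy => ?_) (Finset.measure_zero _ _)
      have hy' : MvPolynomial.eval (Fin.cons y s : Fin (n + 1) → ℝ) p = 0 := hy
      rw [MvPolynomial.eval_eq_eval_mv_eval'] at hy'
      simpa [hr] using hy'
    have hmp := (Measure.measurePreserving_swap (μ := (volume : Measure ℝ))
      (ν := (volume : Measure (Fin n → ℝ)))).comp
      (volume_preserving_piFinSuccAbove (fun _ : Fin (n + 1) => ℝ) 0)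
    have := hmp.measure_preimage hAm.nullMeasurableSet
    rw [hA0] at this
    convert this using 2
    ext x
    simp [hA, MeasurableEquiv.piFinSuccAbove, Fin.insertNthEquiv]

/-- A nonnegative continuous function with null level sets has a sublevel set of any prescribed
measure inside a compact set. -/
theorem exists_measureReal_sublevel_eq {X : Type*} [TopologicalSpace X] [MeasurableSpace X]
    [OpensMeasurableSpace X] {μ : Measure X} [IsFiniteMeasureOnCompacts μ] {B : Set X}
    (hB : IsCompact B) {g : X → ℝ} (hg : Continuous g) (hg0 : ∀ x, 0 ≤ g x)
    (hnull : ∀ t, μ {x | g x = t} = 0) {a : ℝ} (ha : 0 ≤ a) (haB : a ≤ μ.real B) :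
    ∃ t, μ.real (B ∩ {x | g x ≤ t}) = a := by
  have : IsFiniteMeasure (μ.restrict B) := ⟨by simpa using hB.measure_lt_top⟩
  set ν := (μ.restrict B).map g with hν
  have : NullSingletonClass ν := ⟨fun t => by
    rw [hν, Measure.map_apply hg.measurable (measurableSet_singleton t)]
    exact nonpos_iff_eq_zero.mp ((Measure.restrict_apply_le _ _).trans (hnull t).le)⟩
  obtain ⟨M, hM⟩ := hB.bddAbove_image hg.continuousOn
  have hM' : ∀ x ∈ B, g x ≤ max M 0 := fun x hx =>
    (hM (mem_image_of_mem g hx)).trans (le_max_left _ _)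
  have hprim : ∀ t, -1 ≤ t → ∫ _ in (-1 : ℝ)..t, (1 : ℝ) ∂ν = μ.real (B ∩ {x | g x ≤ t}) := by
    intro t ht
    rw [intervalIntegral.integral_of_le ht, setIntegral_const, smul_eq_mul, mul_one, hν,
      map_measureReal_apply hg.measurable measurableSet_Ioc,
      measureReal_restrict_apply (hg.measurable measurableSet_Ioc), inter_comm]
    congr 2
    ext x
    simpa using fun _ => lt_of_lt_of_le (by norm_num) (hg0 x)
  have hcont : Continuous fun t => ∫ _ in (-1 : ℝ)..t, (1 : ℝ) ∂ν :=
    intervalIntegral.continuous_primitive (fun _ _ => intervalIntegrable_const) _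
  have hle : (-1 : ℝ) ≤ max M 0 := le_trans (by norm_num) (le_max_right _ _)
  obtain ⟨t, ht, hta⟩ := intermediate_value_Icc hle hcont.continuousOn
    (show a ∈ Icc _ _ from ⟨by simpa using ha, by
      rwa [hprim _ hle, inter_eq_left.mpr (show B ⊆ {x | g x ≤ max M 0} from hM')]⟩)
  exact ⟨t, by rw [← hprim t ht.1]; exact hta⟩

/-- A set containing the small values of `f`, of minimal admissible measure, minimizes the
integral of `f`. -/
theorem setIntegral_le_setIntegral_of_le_of_ge {X : Type*} [MeasurableSpace X] {μ : Measure X}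
    {B S S' : Set X} (hB : μ B ≠ ∞) (hS : MeasurableSet S) (hS' : MeasurableSet S')
    (hSB : S ⊆ B) (hSB' : S' ⊆ B) {f : X → ℝ} (hf : IntegrableOn f B μ) {t : ℝ} (ht : 0 ≤ t)
    (hfS : ∀ x ∈ S, f x ≤ t) (hfB : ∀ x ∈ B \ S, t ≤ f x) (hvol : μ.real S ≤ μ.real S') :
    ∫ x in S, f x ∂μ ≤ ∫ x in S', f x ∂μ := by
  have hconst : IntegrableOn (fun _ : X => t) B μ := integrableOn_const hB
  have hsub := hf.sub hconst
  have key : ∫ x in S, (f x - t) ∂μ ≤ ∫ x in S', (f x - t) ∂μ := by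
    rw [← integral_indicator hS, ← integral_indicator hS']
    refine integral_mono ((hsub.mono_set hSB).integrable_indicator hS)
      ((hsub.mono_set hSB').integrable_indicator hS') fun x => ?_
    by_cases hx : x ∈ S <;> by_cases hx' : x ∈ S'
    · simp [hx, hx']
    · simpa [hx, hx'] using hfS x hx
    · simpa [hx, hx'] using hfB x ⟨hSB' hx', hx⟩
    · simp [hx, hx']
  rw [integral_sub (hf.mono_set hSB) (hconst.mono_set hSB),
    integral_sub (hf.mono_set hSB') (hconst.mono_set hSB'), setIntegral_const,
    setIntegral_const, smul_eq_mul, smul_eq_mul] at key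
  nlinarith [mul_le_mul_of_nonneg_right hvol ht]

variable {d l : ℕ}

/-- The multivariate polynomial with coefficient vector `W`. -/
def coeffPoly (W : MultiIdx d l → ℝ) : MvPolynomial (Fin d) ℝ :=
  ∑ s, MvPolynomial.monomial (Finsupp.equivFunOnFinite.symm fun i => (s.1 i : ℕ)) (W s)

theorem eval_coeffPoly (W : MultiIdx d l → ℝ) (u : Euc d) :
    MvPolynomial.eval (WithLp.ofLp u) (coeffPoly W) = polyEval W u := by
  simp [coeffPoly, polyEval, mon, MvPolynomial.eval_monomial, Finsupp.prod_fintype]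

theorem coeffPoly_ne_zero {W : MultiIdx d l → ℝ} (hW : ∑ s, W s ^ 2 = 1) : coeffPoly W ≠ 0 := by
  intro h
  have hz : ∀ s, W s = 0 := by
    intro s
    have hs := congrArg
      (MvPolynomial.coeff (Finsupp.equivFunOnFinite.symm fun i => (s.1 i : ℕ))) h
    rw [coeffPoly, MvPolynomial.coeff_sum, Finset.sum_eq_single s] at hs
    · simpa using hs
    · intro r _ hrs
      rw [MvPolynomial.coeff_monomial, if_neg]
      intro he
      refine hrs (Subtype.ext (funext fun i => Fin.ext ?_))
      exact congrFun (Finsupp.equivFunOnFinite.symm.injective he) i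
    · simp
  simp [hz] at hW

theorem volume_eval_ofLp_eq_zero {p : MvPolynomial (Fin d) ℝ} (hp : p ≠ 0) :
    volume {u : Euc d | MvPolynomial.eval (WithLp.ofLp u) p = 0} = 0 := by
  have hm : MeasurableSet {x : Fin d → ℝ | MvPolynomial.eval x p = 0} :=
    (isClosed_singleton.preimage (MvPolynomial.continuous_eval p)).measurableSet
  rw [← volume_eval_mvPolynomial_eq_zero hp]
  exact (PiLp.volume_preserving_ofLp (Fin d)).measure_preimage hm.nullMeasurableSet

theorem continuous_polyEval_uncurry :
    Continuous fun z : (MultiIdx d l → ℝ) × Euc d => polyEval z.1 z.2 := by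
  unfold polyEval mon
  fun_prop

theorem continuous_polyEval (W : MultiIdx d l → ℝ) : Continuous (polyEval W) :=
  continuous_polyEval_uncurry.comp (by fun_prop : Continuous fun u : Euc d => (W, u))

/-- For fixed coefficients, the integral of the squared polynomial has a minimizing set. -/
theorem exists_isCompact_forall_setIntegral_sq_le (hd : 1 ≤ d) {c a : ℝ} (ha : 0 < a)
    (ha' : a ≤ (volume (Metric.closedBall (0 : Euc d) c)).toReal) (W : MultiIdx d l → ℝ) :
    ∃ S : Set (Euc d), IsCompact S ∧ S ⊆ Metric.closedBall 0 c ∧ volume.real S = a ∧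
      ∀ S' : Set (Euc d), IsCompact S' → S' ⊆ Metric.closedBall 0 c → a ≤ volume.real S' →
        ∫ u in S, polyEval W u ^ 2 ≤ ∫ u in S', polyEval W u ^ 2 := by
  have hB : IsCompact (Metric.closedBall (0 : Euc d) c) := isCompact_closedBall _ _
  have hcont : Continuous fun u : Euc d => polyEval W u ^ 2 := (continuous_polyEval W).pow 2
  have hint := hcont.continuousOn.integrableOn_compact (μ := volume) hB
  suffices ∃ (S : Set (Euc d)) (t : ℝ), IsCompact S ∧ S ⊆ Metric.closedBall 0 c ∧
      volume.real S = a ∧ (∀ u ∈ S, polyEval W u ^ 2 ≤ t) ∧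
      ∀ u ∈ Metric.closedBall 0 c \ S, t ≤ polyEval W u ^ 2 by
    obtain ⟨S, t, hS, hSB, hSa, h1, h2⟩ := this
    refine ⟨S, hS, hSB, hSa, fun S' hS' hSB' hSa' => ?_⟩
    have hne : S.Nonempty := by
      rw [nonempty_iff_ne_empty]
      rintro rfl
      simp at hSa
      linarith
    obtain ⟨x, hx⟩ := hne
    exact setIntegral_le_setIntegral_of_le_of_ge hB.measure_lt_top.ne hS.measurableSet
      hS'.measurableSet hSB hSB' hint ((sq_nonneg _).trans (h1 x hx)) h1 h2 (hSa.trans_le hSa')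
  by_cases hconst : ∃ t, coeffPoly W ^ 2 = MvPolynomial.C t
  · obtain ⟨t, ht⟩ := hconst
    have hval : ∀ u, polyEval W u ^ 2 = t := fun u => by
      rw [← eval_coeffPoly, ← map_pow, ht, MvPolynomial.eval_C]
    have : Nonempty (Fin d) := ⟨⟨0, hd⟩⟩
    obtain ⟨r, hr⟩ := exists_measureReal_sublevel_eq (μ := volume) hB
      (continuous_norm (E := Euc d)) norm_nonneg (fun r => by
        simpa [Metric.sphere] using Measure.addHaar_sphere volume (0 : Euc d) r) ha.le ha'
    exact ⟨_, t, hB.inter_right (isClosed_le continuous_norm continuous_const), inter_subset_left,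
      hr, fun u _ => (hval u).le, fun u _ => (hval u).ge⟩
  · push Not at hconst
    obtain ⟨t, ht⟩ := exists_measureReal_sublevel_eq (μ := volume) hB hcont
      (fun _ => sq_nonneg _) (fun t => by
        have := volume_eval_ofLp_eq_zero (sub_ne_zero.mpr (hconst t))
        simpa [eval_coeffPoly, sub_eq_zero] using this) ha.le ha'
    refine ⟨_, t, hB.inter_right (isClosed_le hcont continuous_const), inter_subset_left, ht,
      fun u hu => hu.2, fun u hu => ?_⟩
    exact (not_le.mp fun h => hu.2 ⟨hu.1, h⟩).le

theorem statement19 (d l : ℕ) (hd : 1 ≤ d) (c a : ℝ) (hc : 0 < c) (ha : 0 < a)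
    (ha' : a ≤ (volume (Metric.closedBall (0 : Euc d) c)).toReal) :
    ∃ (W₀ : MultiIdx d l → ℝ) (S₀ : Set (Euc d)),
      (∑ s : MultiIdx d l, W₀ s ^ 2 = 1) ∧ IsCompact S₀ ∧
      S₀ ⊆ Metric.closedBall 0 c ∧ ENNReal.ofReal a ≤ volume S₀ ∧
      (0 < ∫ u in S₀, polyEval W₀ u ^ 2) ∧
      ∀ (W : MultiIdx d l → ℝ) (S : Set (Euc d)),
        (∑ s : MultiIdx d l, W s ^ 2 = 1) → IsCompact S → S ⊆ Metric.closedBall 0 c →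
        ENNReal.ofReal a ≤ volume S →
        (∫ u in S₀, polyEval W₀ u ^ 2) ≤ ∫ u in S, polyEval W u ^ 2 := by
  have hB : IsCompact (Metric.closedBall (0 : Euc d) c) := isCompact_closedBall _ _
  have hle : ∀ {S : Set (Euc d)}, IsCompact S → (ENNReal.ofReal a ≤ volume S ↔ a ≤ volume.real S) :=
    fun hS => ENNReal.ofReal_le_iff_le_toReal hS.measure_lt_top.ne
  choose S hS hSB hSa hmin using
    exists_isCompact_forall_setIntegral_sq_le (l := l) hd ha ha'
  set G : (MultiIdx d l → ℝ) → ℝ := fun W => ∫ u in S W, polyEval W u ^ 2 with hG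
  have hsq : ∀ W : MultiIdx d l → ℝ, Continuous fun u => polyEval W u ^ 2 :=
    fun W => (continuous_polyEval W).pow 2
  have hcomp : ∀ V W, G V ≤ G W +
      ∫ u in Metric.closedBall (0 : Euc d) c, |polyEval V u ^ 2 - polyEval W u ^ 2| := by
    intro V W
    have hi : ∀ {T : Set (Euc d)}, IsCompact T →
        IntegrableOn (fun u => |polyEval V u ^ 2 - polyEval W u ^ 2|) T :=
      fun hT => ((hsq V).sub (hsq W)).abs.continuousOn.integrableOn_compact hT
    have hiW := (hsq W).continuousOn.integrableOn_compact (μ := volume) (hS W)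
    calc G V ≤ ∫ u in S W, polyEval V u ^ 2 := hmin V _ (hS W) (hSB W) (hSa W).ge
      _ ≤ ∫ u in S W, (polyEval W u ^ 2 + |polyEval V u ^ 2 - polyEval W u ^ 2|) :=
        setIntegral_mono ((hsq V).continuousOn.integrableOn_compact (hS W))
          (hiW.add (hi (hS W))) fun u => by
            linarith [le_abs_self (polyEval V u ^ 2 - polyEval W u ^ 2)]
      _ = G W + ∫ u in S W, |polyEval V u ^ 2 - polyEval W u ^ 2| :=
        integral_add hiW (hi (hS W))
      _ ≤ _ := add_le_add_right (setIntegral_mono_set (hi hB)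
        (Eventually.of_forall fun _ => abs_nonneg _) (hSB W).eventuallyLE) _
  have hGcont : Continuous G := by
    rw [continuous_iff_continuousAt]
    intro W
    set D : (MultiIdx d l → ℝ) → ℝ := fun V =>
      ∫ u in Metric.closedBall (0 : Euc d) c, |polyEval V u ^ 2 - polyEval W u ^ 2| with hD
    have hDcont : Continuous D := by
      refine continuous_parametric_integral_of_continuous ?_ hB
      have h1 := continuous_polyEval_uncurry (d := d) (l := l)
      have h2 := (continuous_polyEval W).comp
        (continuous_snd : Continuous (Prod.snd : (MultiIdx d l → ℝ) × Euc d → Euc d))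
      exact ((h1.pow 2).sub (h2.pow 2)).abs
    have hD0 : D W = 0 := by simp [hD]
    rw [ContinuousAt, tendsto_iff_dist_tendsto_zero]
    refine squeeze_zero (fun _ => dist_nonneg) (fun V => ?_) (hD0 ▸ hDcont.tendsto W)
    have h := hcomp W V
    simp_rw [abs_sub_comm (polyEval W _ ^ 2)] at h
    rw [Real.dist_eq, abs_le]
    constructor <;> linarith [hcomp V W]
  have hK : IsCompact {W : MultiIdx d l → ℝ | ∑ s, W s ^ 2 = 1} := by
    refine (isCompact_Icc (a := fun _ => (-1 : ℝ)) (b := fun _ => 1)).of_isClosed_subset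
      (isClosed_eq (by fun_prop) continuous_const) fun W hW => ?_
    have h : ∀ s, |W s| ≤ 1 := fun s => by
      rw [← sq_le_one_iff_abs_le_one, ← show ∑ s, W s ^ 2 = 1 from hW]
      exact Finset.single_le_sum (f := fun s => W s ^ 2) (fun _ _ => sq_nonneg _)
        (Finset.mem_univ s)
    exact ⟨fun s => (abs_le.mp (h s)).1, fun s => (abs_le.mp (h s)).2⟩
  have hne : {W : MultiIdx d l → ℝ | ∑ s, W s ^ 2 = 1}.Nonempty := by
    refine ⟨Pi.single ⟨fun _ => 0, by simp⟩ 1, ?_⟩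
    simp [Pi.single_apply]
  obtain ⟨W₀, hW₀, hW₀min⟩ := hK.exists_isMinOn hne hGcont.continuousOn
  refine ⟨W₀, S W₀, hW₀, hS W₀, hSB W₀, (hle (hS W₀)).mpr (hSa W₀).ge, ?_,
    fun W T hW hT hTB hTa => (hW₀min hW).trans (hmin W T hT hTB ((hle hT).mp hTa))⟩
  rw [setIntegral_pos_iff_support_of_nonneg_ae (Eventually.of_forall fun _ => sq_nonneg _)
    ((hsq W₀).continuousOn.integrableOn_compact (hS W₀))]
  have hnull : volume {u : Euc d | polyEval W₀ u = 0} = 0 := by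
    simpa only [eval_coeffPoly] using volume_eval_ofLp_eq_zero (coeffPoly_ne_zero hW₀)
  have hsupp : Function.support (fun u => polyEval W₀ u ^ 2) ∩ S W₀ =
      S W₀ \ {u | polyEval W₀ u = 0} := by
    ext u
    simp [and_comm]
  rw [hsupp, measure_sdiff_null hnull]
  exact (ENNReal.ofReal_pos.mpr ha).trans_le ((hle (hS W₀)).mpr (hSa W₀).ge)
end
end
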